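/- arXiv:1402.7099 — 2 statements merged into one kernel-verified Lean document; each statement's English description precedes it below -/
import Mathlib

section
/- Let α be a contact form on ℝ³ whose Reeb vector field R_α is complete. Then the vector field X(p, x, y) = (xy/2)·R_α(p) on ℝ³ × ℝ²(x, y) is complete; and if τ denotes its time-1 flow, the map Ψ : ℝ³ × ℝ² → ℝ³ × ℝ², Ψ(p, x, y) = (τ(p, x, y), x, y), is a diffeomorphism preserving the fibres of the projection onto ℝ²(x, y) and satisfying Ψ*(α − y dx) = α + ½(x dy − y dx). In particular (ℝ³ × ℝ², ker(α + ½(x dy − y dx))) is strictly contactomorphic to (ℝ³ × ℝ², ker(α − y dx)). -/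
/-!
STATEMENT 7 (Lemma `lem:s`): For a contact form α on ℝ³ with complete Reeb field
R_α, the vector field X(p,x,y) = (xy/2)·R_α(p) on ℝ³ × ℝ² is complete, and its
time-1 flow Ψ is a fibre-preserving diffeomorphism with
Ψ*(α - y dx) = α + ½(x dy - y dx); i.e. a strict contactomorphism
(ℝ³ × ℝ², ker(α + ½(x dy - y dx))) → (ℝ³ × ℝ², ker(α - y dx)).
-/

noncomputable section

abbrev V3 : Type := Fin 3 → ℝ

def e3 (i : Fin 3) : V3 := Pi.single i 1

def d2 {E : Type*} [NormedAddCommGroup E] [NormedSpace ℝ E]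
    (α : E → E →L[ℝ] ℝ) (x v w : E) : ℝ :=
  fderiv ℝ α x v w - fderiv ℝ α x w v

def IsContactForm3 (α : V3 → V3 →L[ℝ] ℝ) : Prop :=
  ContDiff ℝ (⊤ : ℕ∞) α ∧ ∀ p : V3,
    α p (e3 0) * d2 α p (e3 1) (e3 2)
      - α p (e3 1) * d2 α p (e3 0) (e3 2)
      + α p (e3 2) * d2 α p (e3 0) (e3 1) ≠ 0

section Helpers

open Set Metric

lemma aux_icc_ici {F : Type*} [NormedAddCommGroup F] [NormedSpace ℝ F] {w : ℝ → F} {w' : F} {t : ℝ}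
    (ht : t ∈ Ico (0:ℝ) 1) (h : HasDerivWithinAt w w' (Icc 0 1) t) :
    HasDerivWithinAt w w' (Ici t) t := by
  apply h.mono_of_mem_nhdsWithin
  have : Icc t 1 ∈ nhdsWithin t (Ici t) := Icc_mem_nhdsGE ht.2
  exact Filter.mem_of_superset this (Icc_subset_Icc_left ht.1)

lemma lin_ode {G : Type*} [NormedAddCommGroup G] [NormedSpace ℝ G] [FiniteDimensional ℝ G]
    (A : ℝ → G →L[ℝ] G) (hA : ContinuousOn A (Icc 0 1)) (w0 : G) :
    ∃ w : ℝ → G, w 0 = w0 ∧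
      ∀ t ∈ Icc (0:ℝ) 1, HasDerivWithinAt w (A t (w t)) (Icc 0 1) t := by
  have : CompleteSpace G := FiniteDimensional.complete ℝ G
  have : ProperSpace G := FiniteDimensional.proper ℝ G
  obtain ⟨M0, hM0⟩ := isCompact_Icc.exists_bound_of_continuousOn hA
  set M : NNReal := ⟨max M0 0, le_max_right _ _⟩ with hMdef
  have hM : ∀ t ∈ Icc (0:ℝ) 1, ‖A t‖ ≤ M := fun t ht => (hM0 t ht).trans (le_max_left _ _)
  set ρ : ℝ := ‖w0‖ * Real.exp M + 1 with hρ
  have hρpos : 0 < ρ := by positivity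
  let χ : ContDiffBump (0:G) := ⟨ρ, ρ + 1, hρpos, by linarith⟩
  let g : G → G := fun v => χ v • v
  have hgc : ContDiff ℝ 1 g := χ.contDiff.smul contDiff_id
  have hgs : HasCompactSupport g := χ.hasCompactSupport.smul_right
  obtain ⟨C, hC⟩ := ContDiff.lipschitzWith_of_hasCompactSupport hgs hgc one_ne_zero
  obtain ⟨B0, hB0⟩ := hgs.exists_bound_of_continuous hgc.continuous
  set B : NNReal := ⟨max B0 0, le_max_right _ _⟩ with hBdef
  have hB : ∀ v, ‖g v‖ ≤ B := fun v => (hB0 v).trans (le_max_left _ _)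
  have hPL : IsPicardLindelof (fun t v => A t (g v)) (⟨0, by simp⟩ : Icc (0:ℝ) 1) w0
      (M * B) 0 (M * B) (M * C) := by
    refine ⟨fun t ht => ?_, fun x _ => hA.clm_apply continuousOn_const, fun t ht x _ => ?_, ?_⟩
    · have h1 : LipschitzWith M (A t) :=
        (A t).lipschitz.weaken (by exact_mod_cast hM t ht)
      exact (h1.comp hC).lipschitzOnWith
    · refine ((A t).le_opNorm _).trans ?_
      push_cast
      exact mul_le_mul (hM t ht) (hB x) (norm_nonneg _) M.2
    · simp
  obtain ⟨w, hw0, hw⟩ := hPL.exists_eq_forall_mem_Icc_hasDerivWithinAt₀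
  refine ⟨w, hw0, fun t ht => ?_⟩
  have hbd := norm_le_gronwallBound_of_norm_deriv_right_le (f := w) (f' := fun t => A t (g (w t)))
    (δ := ‖w0‖) (K := M) (ε := 0) (a := 0) (b := 1)
    (fun t ht => (hw t ht).continuousWithinAt)
    (fun t ht => aux_icc_ici ht (hw t (Ico_subset_Icc_self ht))) (by rw [← hw0])
    (fun t ht => by
      refine ((A t).le_opNorm _).trans ?_
      rw [add_zero]
      refine mul_le_mul (hM t (Ico_subset_Icc_self ht)) ?_ (norm_nonneg _) M.2
      rw [norm_smul, Real.norm_of_nonneg χ.nonneg]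
      exact mul_le_of_le_one_left (norm_nonneg _) χ.le_one) t ht
  have hg : g (w t) = w t := by
    have : χ (w t) = 1 := by
      apply χ.one_of_mem_closedBall
      rw [mem_closedBall_zero_iff]
      rw [gronwallBound_ε0] at hbd
      refine hbd.trans ?_
      have : Real.exp (M * (t - 0)) ≤ Real.exp M := by
        apply Real.exp_le_exp.2
        have := M.2
        have h2 := ht.2
        simp only [sub_zero]
        exact mul_le_of_le_one_right M.2 h2
      change ‖w0‖ * _ ≤ ρ
      nlinarith [norm_nonneg w0]
    simp [g, this]
  have := hw t ht
  simp only [hg] at this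
  exact this

/-- `Φ` is a flow of `f` on time interval `[0,1]`. -/
def IsFlow01 {E : Type*} [NormedAddCommGroup E] [NormedSpace ℝ E] (f : E → E) (Φ : ℝ → E → E) :
    Prop :=
  (∀ p, Φ 0 p = p) ∧ ∀ p, ∀ t ∈ Icc (0:ℝ) 1,
    HasDerivWithinAt (fun u => Φ u p) (f (Φ t p)) (Icc 0 1) t

lemma flow_hasFDerivAt {E : Type*} [NormedAddCommGroup E] [NormedSpace ℝ E] [FiniteDimensional ℝ E]
    (f : E → E) (hf : ContDiff ℝ 1 f) (Φ : ℝ → E → E) (hΦ : IsFlow01 f Φ) (x₀ : E) :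
    ∃ W : ℝ → E →L[ℝ] E, W 0 = ContinuousLinearMap.id ℝ E ∧
      (∀ t ∈ Icc (0:ℝ) 1, HasDerivWithinAt W ((fderiv ℝ f (Φ t x₀)).comp (W t)) (Icc 0 1) t) ∧
      HasFDerivAt (Φ 1) (W 1) x₀ := by
  have : ProperSpace E := FiniteDimensional.proper ℝ E
  obtain ⟨h0, hd⟩ := hΦ
  have hcont : ∀ p, ContinuousOn (fun u => Φ u p) (Icc 0 1) :=
    fun p t ht => (hd p t ht).continuousWithinAt
  have hDf : Continuous (fderiv ℝ f) := hf.continuous_fderiv one_ne_zero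
  have hdf : ∀ x, HasFDerivAt f (fderiv ℝ f x) x :=
    fun x => (hf.differentiable one_ne_zero x).hasFDerivAt
  have hAc : ContinuousOn (fun t => fderiv ℝ f (Φ t x₀)) (Icc 0 1) :=
    hDf.comp_continuousOn (hcont x₀)
  obtain ⟨W, hW0, hW⟩ := lin_ode
    (fun t => ContinuousLinearMap.compL ℝ E E E (fderiv ℝ f (Φ t x₀)))
    ((ContinuousLinearMap.compL ℝ E E E).continuous.comp_continuousOn hAc)
    (ContinuousLinearMap.id ℝ E)
  simp only [ContinuousLinearMap.compL_apply] at hW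
  refine ⟨W, hW0, hW, ?_⟩
  -- bounds
  obtain ⟨ρ, hρ⟩ := isCompact_Icc.exists_bound_of_continuousOn (hcont x₀)
  have hρ0 : 0 ≤ ρ := (norm_nonneg _).trans (hρ 0 (by simp))
  have hcpt : IsCompact (closedBall (0:E) (ρ + 1)) := isCompact_closedBall _ _
  obtain ⟨M0, hM0⟩ := hcpt.exists_bound_of_continuousOn hDf.continuousOn
  set M : ℝ := max M0 1 with hMd
  have hM1 : 1 ≤ M := le_max_right _ _
  have hM : ∀ x ∈ closedBall (0:E) (ρ + 1), ‖fderiv ℝ f x‖ ≤ M :=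
    fun x hx => (hM0 x hx).trans (le_max_left _ _)
  have hin : ∀ t ∈ Icc (0:ℝ) 1, ∀ y, ‖y - Φ t x₀‖ ≤ 1 → y ∈ closedBall (0:E) (ρ + 1) := by
    intro t ht y hy
    rw [mem_closedBall_zero_iff]
    have h1 := hρ t ht
    have h2 := norm_add_le (y - Φ t x₀) (Φ t x₀)
    rw [sub_add_cancel] at h2
    linarith
  -- Lipschitz estimate
  set C : ℝ := Real.exp (M + 1) with hC
  have hCpos : 0 < C := Real.exp_pos _
  have hlip : ∀ x, ‖x - x₀‖ * C ≤ 1 → ∀ t ∈ Icc (0:ℝ) 1,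
      ‖Φ t x - Φ t x₀‖ ≤ ‖x - x₀‖ * C := by
    intro x hx t ht
    rcases eq_or_ne x x₀ with rfl | hne
    · simp
    have hpos : 0 < ‖x - x₀‖ := norm_pos_iff.2 (sub_ne_zero.2 hne)
    have hBle : ∀ t ∈ Icc (0:ℝ) 1, ‖x - x₀‖ * Real.exp ((M + 1) * t) ≤ ‖x - x₀‖ * C := by
      intro t ht
      apply mul_le_mul_of_nonneg_left _ hpos.le
      apply Real.exp_le_exp.2
      exact mul_le_of_le_one_right (by linarith) ht.2
    have key := image_norm_le_of_norm_deriv_right_lt_deriv_boundary'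
      (f := fun t => Φ t x - Φ t x₀) (f' := fun t => f (Φ t x) - f (Φ t x₀)) (a := 0) (b := 1)
      ((hcont x).sub (hcont x₀))
      (fun t ht => (aux_icc_ici ht (hd x t (Ico_subset_Icc_self ht))).sub
        (aux_icc_ici ht (hd x₀ t (Ico_subset_Icc_self ht))))
      (B := fun t => ‖x - x₀‖ * Real.exp ((M + 1) * t))
      (B' := fun t => ‖x - x₀‖ * (Real.exp ((M + 1) * t) * ((M + 1) * 1)))
      (by simp [h0]) (by fun_prop)
      (fun t _ => ((((hasDerivAt_id t).const_mul (M + 1)).exp).const_mul _).hasDerivWithinAt)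
      (by
        intro t ht heq
        have ht' := Ico_subset_Icc_self ht
        have hle : ‖Φ t x - Φ t x₀‖ ≤ 1 := by
          rw [heq]; exact (hBle t ht').trans hx
        have := (convex_closedBall (0:E) (ρ+1)).norm_image_sub_le_of_norm_hasFDerivWithin_le
          (fun x _ => (hdf x).hasFDerivWithinAt) hM
          (hin t ht' (Φ t x₀) (by simp)) (hin t ht' (Φ t x) hle)
        refine this.trans_lt ?_
        rw [heq]
        have : 0 < ‖x - x₀‖ * Real.exp ((M + 1) * t) := by positivity
        nlinarith) ht
    exact key.trans (hBle t ht)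
  rw [hasFDerivAt_iff_isLittleO, Asymptotics.isLittleO_iff]
  intro c hc
  have huc := hcpt.uniformContinuousOn_of_continuous hDf.continuousOn
  rw [Metric.uniformContinuousOn_iff] at huc
  set ε : ℝ := c / (C * Real.exp M) with hε
  have hεpos : 0 < ε := by positivity
  obtain ⟨δ, hδ, huc⟩ := huc ε hεpos
  have hnear : ∀ᶠ x in nhds x₀, ‖x - x₀‖ * C < min 1 δ := by
    have : Continuous fun x => ‖x - x₀‖ * C := by fun_prop
    apply this.continuousAt.eventually_lt continuousAt_const
    simp [hδ]
  filter_upwards [hnear] with x hx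
  have hx1 : ‖x - x₀‖ * C ≤ 1 := (hx.trans_le (min_le_left _ _)).le
  have hxδ : ‖x - x₀‖ * C < δ := hx.trans_le (min_le_right _ _)
  have hL := hlip x hx1
  have hest : ∀ t ∈ Icc (0:ℝ) 1, ‖f (Φ t x) - f (Φ t x₀) - fderiv ℝ f (Φ t x₀) (Φ t x - Φ t x₀)‖
      ≤ ε * ‖Φ t x - Φ t x₀‖ := by
    intro t ht
    have hLt := hL t ht
    set r := ‖x - x₀‖ * C
    have hr0 : 0 ≤ r := by positivity
    refine (convex_closedBall (Φ t x₀) r).norm_image_sub_le_of_norm_hasFDerivWithin_le'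
      (fun x _ => (hdf x).hasFDerivWithinAt) (fun y hy => ?_) (mem_closedBall_self hr0)
      (mem_closedBall_iff_norm.2 hLt)
    rw [← dist_eq_norm]
    have hy' := mem_closedBall_iff_norm.1 hy
    exact (huc y (hin t ht y (hy'.trans hx1)) (Φ t x₀) (hin t ht _ (by simp))
      ((mem_closedBall.1 hy).trans_lt hxδ)).le
  have hWd : ∀ t ∈ Icc (0:ℝ) 1, HasDerivWithinAt (fun t => W t (x - x₀))
      (fderiv ℝ f (Φ t x₀) (W t (x - x₀))) (Icc 0 1) t := by
    intro t ht
    have := (hW t ht).clm_apply (hasDerivWithinAt_const t (Icc (0:ℝ) 1) (x - x₀))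
    simpa using this
  have hder : ∀ t ∈ Icc (0:ℝ) 1, HasDerivWithinAt (fun t => Φ t x - Φ t x₀ - W t (x - x₀))
      (f (Φ t x) - f (Φ t x₀) - fderiv ℝ f (Φ t x₀) (W t (x - x₀))) (Icc 0 1) t :=
    fun t ht => ((hd x t ht).sub (hd x₀ t ht)).sub (hWd t ht)
  have hG := norm_le_gronwallBound_of_norm_deriv_right_le
    (f := fun t => Φ t x - Φ t x₀ - W t (x - x₀))
    (f' := fun t => f (Φ t x) - f (Φ t x₀) - fderiv ℝ f (Φ t x₀) (W t (x - x₀)))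
    (δ := 0) (K := M) (ε := ε * (‖x - x₀‖ * C)) (a := 0) (b := 1)
    (fun t ht => (hder t ht).continuousWithinAt)
    (fun t ht => aux_icc_ici ht (hder t (Ico_subset_Icc_self ht)))
    (by simp [h0, hW0])
    (by
      intro t ht
      have ht' := Ico_subset_Icc_self ht
      have e : f (Φ t x) - f (Φ t x₀) - fderiv ℝ f (Φ t x₀) (W t (x - x₀)) =
        fderiv ℝ f (Φ t x₀) (Φ t x - Φ t x₀ - W t (x - x₀)) +
        (f (Φ t x) - f (Φ t x₀) - fderiv ℝ f (Φ t x₀) (Φ t x - Φ t x₀)) := by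
        rw [map_sub (fderiv ℝ f (Φ t x₀)) (Φ t x - Φ t x₀)]; abel
      rw [e]
      refine (norm_add_le _ _).trans (add_le_add ?_ ?_)
      · exact (ContinuousLinearMap.le_opNorm _ _).trans
          (mul_le_mul_of_nonneg_right (hM _ (hin t ht' _ (by simp))) (norm_nonneg _))
      · exact (hest t ht').trans (mul_le_mul_of_nonneg_left (hL t ht') hεpos.le))
    1 (by simp)
  refine hG.trans ?_
  rw [gronwallBound_of_K_ne_0 (by linarith)]
  have hMe : 0 < Real.exp M := Real.exp_pos _
  have h1 : ε * (‖x - x₀‖ * C) / M ≤ ε * (‖x - x₀‖ * C) :=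
    div_le_self (by positivity) hM1
  have h2 : c * ‖x - x₀‖ = ε * (‖x - x₀‖ * C) * Real.exp M := by
    rw [hε]; field_simp
  rw [h2]
  have h3 : 0 ≤ ε * (‖x - x₀‖ * C) := by positivity
  have h4 : (1:ℝ) ≤ Real.exp M := Real.one_le_exp (by linarith)
  simp only [zero_mul, zero_add, sub_zero, mul_one]
  calc _ ≤ ε * (‖x - x₀‖ * C) * (Real.exp M - 1) :=
        mul_le_mul_of_nonneg_right h1 (by linarith)
    _ ≤ _ := by nlinarith

lemma flow_contDiff_nat (n : ℕ) : ∀ {E : Type} [NormedAddCommGroup E] [NormedSpace ℝ E]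
    [FiniteDimensional ℝ E] (f : E → E) (_ : ContDiff ℝ (⊤ : ℕ∞) f) (Φ : ℝ → E → E)
    (_ : IsFlow01 f Φ), ContDiff ℝ n (Φ 1) := by
  induction n with
  | zero =>
    intro E _ _ _ f hf Φ hΦ
    have hd : Differentiable ℝ (Φ 1) := fun x => by
      obtain ⟨W, _, _, h⟩ := flow_hasFDerivAt f (hf.of_le (by exact_mod_cast le_top)) Φ hΦ x
      exact h.differentiableAt
    exact contDiff_zero.2 hd.continuous
  | succ n ih =>
    intro E _ _ _ f hf Φ hΦ
    choose W hW0 hW hWd using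
      flow_hasFDerivAt f (hf.of_le (by exact_mod_cast le_top)) Φ hΦ
    push_cast
    rw [contDiff_succ_iff_fderiv]
    refine ⟨fun x => (hWd x).differentiableAt, by simp, ?_⟩
    rw [contDiff_clm_apply_iff]
    intro v
    have hdf : ContDiff ℝ (⊤ : ℕ∞) (fderiv ℝ f) :=
      hf.fderiv_right (by exact_mod_cast le_top)
    have := ih (E := E × E) (fun z => (f z.1, fderiv ℝ f z.1 z.2))
      ((hf.comp contDiff_fst).prodMk ((hdf.comp contDiff_fst).clm_apply contDiff_snd))
      (fun t z => (Φ t z.1, W z.1 t z.2))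
      ⟨fun p => by simp [hΦ.1, hW0], fun p t ht => by
        refine (hΦ.2 p.1 t ht).prodMk ?_
        have := (hW p.1 t ht).clm_apply (hasDerivWithinAt_const t (Icc (0:ℝ) 1) p.2)
        simpa using this⟩
    have h2 : ContDiff ℝ n (fun x => ((Φ 1 x, W x 1 v) : E × E).2) :=
      contDiff_snd.comp (this.comp (contDiff_id.prodMk contDiff_const (f := fun x : E => x) (g := fun _ => v)))
    convert h2 using 2 with x
    rw [(hWd x).fderiv]

lemma flow_contDiff {E : Type} [NormedAddCommGroup E] [NormedSpace ℝ E]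
    [FiniteDimensional ℝ E] (f : E → E) (hf : ContDiff ℝ (⊤ : ℕ∞) f) (Φ : ℝ → E → E)
    (hΦ : IsFlow01 f Φ) : ContDiff ℝ (⊤ : ℕ∞) (Φ 1) :=
  contDiff_infty.2 fun n => flow_contDiff_nat n f hf Φ hΦ

lemma complete_flow_add {E : Type*} [NormedAddCommGroup E] [NormedSpace ℝ E]
    [FiniteDimensional ℝ E] (f : E → E) (hf : ContDiff ℝ 1 f) (Φ : ℝ → E → E)
    (h0 : ∀ p, Φ 0 p = p) (hd : ∀ p t, HasDerivAt (fun u => Φ u p) (f (Φ t p)) t)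
    (s t : ℝ) (p : E) : Φ t (Φ s p) = Φ (t + s) p := by
  have : ProperSpace E := FiniteDimensional.proper ℝ E
  have hd2 : ∀ u, HasDerivAt (fun u => Φ (u + s) p) (f (Φ (u + s) p)) u :=
    fun u => (hd p (u + s)).comp_add_const u s
  have hc1 : Continuous (fun u => Φ u (Φ s p)) :=
    continuous_iff_continuousAt.2 fun u => (hd _ u).continuousAt
  have hc2 : Continuous (fun u => Φ (u + s) p) :=
    continuous_iff_continuousAt.2 fun u => (hd2 u).continuousAt
  set T : ℝ := |t| + 1
  obtain ⟨r1, hr1⟩ := (isCompact_Icc (a := -T) (b := T)).exists_bound_of_continuousOn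
    hc1.continuousOn
  obtain ⟨r2, hr2⟩ := (isCompact_Icc (a := -T) (b := T)).exists_bound_of_continuousOn
    hc2.continuousOn
  set r := max r1 r2
  obtain ⟨M, hM⟩ := (isCompact_closedBall (0:E) r).exists_bound_of_continuousOn
    (hf.continuous_fderiv one_ne_zero).continuousOn
  set K : NNReal := ⟨max M 0, le_max_right _ _⟩
  have hK : LipschitzOnWith K f (closedBall (0:E) r) := by
    refine (convex_closedBall (0:E) r).lipschitzOnWith_of_nnnorm_fderiv_le
      (fun x _ => hf.differentiable one_ne_zero x) (fun x hx => ?_)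
    exact (hM x hx).trans (le_max_left _ _)
  have := ODE_solution_unique_of_mem_Ioo (v := fun _ => f) (s := fun _ => closedBall (0:E) r)
    (K := K) (a := -T) (b := T) (t₀ := 0) (f := fun u => Φ u (Φ s p))
    (g := fun u => Φ (u + s) p)
    (fun _ _ => hK) (by constructor <;> simp only [T] <;> linarith [abs_nonneg t])
    (fun u hu => ⟨hd _ u, mem_closedBall_zero_iff.2
      ((hr1 u (Ioo_subset_Icc_self hu)).trans (le_max_left _ _))⟩)
    (fun u hu => ⟨hd2 u, mem_closedBall_zero_iff.2
      ((hr2 u (Ioo_subset_Icc_self hu)).trans (le_max_right _ _))⟩)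
    (by simp [h0])
  exact this (by constructor <;> simp only [T] <;> linarith [neg_abs_le t, le_abs_self t])

lemma v3_expand (v : V3) : v = v 0 • e3 0 + v 1 • e3 1 + v 2 • e3 2 := by
  ext i
  fin_cases i <;> simp [e3]

lemma reeb_smooth (α : V3 → V3 →L[ℝ] ℝ) (hα : IsContactForm3 α) (R : V3 → V3)
    (hR1 : ∀ p, α p (R p) = 1) (hR2 : ∀ p v, d2 α p (R p) v = 0) :
    ContDiff ℝ (⊤ : ℕ∞) R := by
  obtain ⟨hs, hne⟩ := hα
  have hda : ContDiff ℝ (⊤ : ℕ∞) (fderiv ℝ α) := hs.fderiv_right (by exact_mod_cast le_top)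
  have ha : ∀ i, ContDiff ℝ (⊤ : ℕ∞) (fun p => α p (e3 i)) := fun i => hs.clm_apply contDiff_const
  have hb : ∀ i j, ContDiff ℝ (⊤ : ℕ∞) (fun p => d2 α p (e3 i) (e3 j)) := fun i j =>
    ((hda.clm_apply contDiff_const).clm_apply contDiff_const).sub
      ((hda.clm_apply contDiff_const).clm_apply contDiff_const)
  set D : V3 → ℝ := fun p => α p (e3 0) * d2 α p (e3 1) (e3 2)
      - α p (e3 1) * d2 α p (e3 0) (e3 2) + α p (e3 2) * d2 α p (e3 0) (e3 1) with hDdef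
  have hD : ContDiff ℝ (⊤ : ℕ∞) D :=
    (((ha 0).mul (hb 1 2)).sub ((ha 1).mul (hb 0 2))).add ((ha 2).mul (hb 0 1))
  have e1 : ∀ p, R p 0 * α p (e3 0) + R p 1 * α p (e3 1) + R p 2 * α p (e3 2) = 1 := by
    intro p
    have := hR1 p
    rw [v3_expand (R p)] at this
    simpa using this
  have anti : ∀ p v w, d2 α p v w = - d2 α p w v := fun p v w => by simp [d2]
  have self : ∀ p v, d2 α p v v = 0 := fun p v => by simp [d2]
  have e2 : ∀ p v, R p 0 * d2 α p (e3 0) v + R p 1 * d2 α p (e3 1) v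
      + R p 2 * d2 α p (e3 2) v = 0 := by
    intro p v
    have := hR2 p v
    rw [v3_expand (R p)] at this
    simp only [d2, map_add, map_smul, add_apply, smul_apply,
      smul_eq_mul] at this ⊢
    linarith
  rw [contDiff_pi]
  have fin : ∀ i, ∀ b : V3 → ℝ, ContDiff ℝ (⊤ : ℕ∞) b → (∀ p, R p i * D p = b p) →
      ContDiff ℝ (⊤ : ℕ∞) (fun p => R p i) := by
    intro i b hb h
    have : (fun p => R p i) = fun p => b p / D p := by
      funext p; rw [eq_div_iff (hne p), h p]
    rw [this]
    exact hb.div hD hne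
  intro i
  fin_cases i
  · refine fin 0 _ (hb 1 2) fun p => ?_
    have h1 := e1 p
    have h2 := e2 p (e3 1)
    have h3 := e2 p (e3 2)
    rw [self, anti p (e3 2) (e3 1)] at h2
    rw [self] at h3
    simp only [hDdef]
    linear_combination d2 α p (e3 1) (e3 2) * h1 + α p (e3 2) * h2 - α p (e3 1) * h3
  · refine fin 1 _ (hb 0 2).neg fun p => ?_
    have h1 := e1 p
    have h2 := e2 p (e3 0)
    have h3 := e2 p (e3 2)
    rw [self, anti p (e3 2) (e3 0), anti p (e3 1) (e3 0)] at h2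
    rw [self] at h3
    simp only [hDdef]
    linear_combination - d2 α p (e3 0) (e3 2) * h1 - α p (e3 2) * h2 + α p (e3 0) * h3
  · refine fin 2 _ (hb 0 1) fun p => ?_
    have h1 := e1 p
    have h2 := e2 p (e3 0)
    have h3 := e2 p (e3 1)
    rw [self, anti p (e3 2) (e3 0), anti p (e3 1) (e3 0)] at h2
    rw [self, anti p (e3 2) (e3 1)] at h3
    simp only [hDdef]
    linear_combination d2 α p (e3 0) (e3 1) * h1 + α p (e3 1) * h2 - α p (e3 0) * h3

/-- The pullback computation. -/
lemma pullback_aux (α : V3 → V3 →L[ℝ] ℝ) (hα : ContDiff ℝ 1 α) (R : V3 → V3)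
    (hR : ContDiff ℝ 1 R)
    (hR1 : ∀ p, α p (R p) = 1) (hR2 : ∀ p v, d2 α p (R p) v = 0)
    (Θ : ℝ → V3 × ℝ × ℝ → V3 × ℝ × ℝ)
    (hX : ContDiff ℝ 1 (fun q : V3 × ℝ × ℝ => (((q.2.1 * q.2.2 / 2) • R q.1, (0:ℝ), (0:ℝ)) : V3 × ℝ × ℝ)))
    (hΘ : IsFlow01 (fun q : V3 × ℝ × ℝ => (((q.2.1 * q.2.2 / 2) • R q.1, (0:ℝ), (0:ℝ)) : V3 × ℝ × ℝ)) Θ)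
    (hfib : ∀ t q, (Θ t q).2 = q.2) (q v : V3 × ℝ × ℝ) :
    α ((Θ 1) q).1 (fderiv ℝ (Θ 1) q v).1 - ((Θ 1) q).2.2 * (fderiv ℝ (Θ 1) q v).2.1
          = α q.1 v.1 + (q.2.1 * v.2.2 - q.2.2 * v.2.1) / 2 := by
  obtain ⟨W, hW0, hW, hWd⟩ := flow_hasFDerivAt _ hX Θ hΘ q
  have hDX : ∀ z w : V3 × ℝ × ℝ, fderiv ℝ (fun q : V3 × ℝ × ℝ =>
      (((q.2.1 * q.2.2 / 2) • R q.1, (0:ℝ), (0:ℝ)) : V3 × ℝ × ℝ)) z w =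
      ((z.2.1 * z.2.2 / 2) • fderiv ℝ R z.1 w.1 + ((z.2.1 * w.2.2 + z.2.2 * w.2.1) / 2) • R z.1,
        (0:ℝ), (0:ℝ)) := by
    intro z w
    have hx : HasFDerivAt (fun q : V3 × ℝ × ℝ => q.2.1) ((ContinuousLinearMap.fst ℝ ℝ ℝ).comp
      (ContinuousLinearMap.snd ℝ V3 (ℝ × ℝ))) z :=
      ((ContinuousLinearMap.fst ℝ ℝ ℝ).comp (ContinuousLinearMap.snd ℝ V3 (ℝ × ℝ))).hasFDerivAt
    have hy : HasFDerivAt (fun q : V3 × ℝ × ℝ => q.2.2) ((ContinuousLinearMap.snd ℝ ℝ ℝ).comp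
      (ContinuousLinearMap.snd ℝ V3 (ℝ × ℝ))) z :=
      ((ContinuousLinearMap.snd ℝ ℝ ℝ).comp (ContinuousLinearMap.snd ℝ V3 (ℝ × ℝ))).hasFDerivAt
    have hRz : HasFDerivAt (fun q : V3 × ℝ × ℝ => R q.1) ((fderiv ℝ R z.1).comp
      (ContinuousLinearMap.fst ℝ V3 (ℝ × ℝ))) z :=
      HasFDerivAt.comp z (hR.differentiable one_ne_zero z.1).hasFDerivAt hasFDerivAt_fst
    have hc : HasFDerivAt (fun q : V3 × ℝ × ℝ => q.2.1 * q.2.2 / 2) _ z :=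
      (hx.mul hy).mul_const (2:ℝ)⁻¹
    have : HasFDerivAt (fun q : V3 × ℝ × ℝ =>
        (((q.2.1 * q.2.2 / 2) • R q.1, (0:ℝ), (0:ℝ)) : V3 × ℝ × ℝ)) _ z :=
      (hc.smul hRz).prodMk (hasFDerivAt_const ((0:ℝ), (0:ℝ)) z)
    rw [HasFDerivAt.fderiv this]
    refine Prod.ext ?_ rfl
    ext i
    simp
    left
    ring
  rw [hWd.fderiv]
  -- the variational solution
  have hw : ∀ t ∈ Icc (0:ℝ) 1, HasDerivWithinAt (fun t => W t v)
      (((q.2.1 * q.2.2 / 2) • fderiv ℝ R (Θ t q).1 (W t v).1 +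
        ((q.2.1 * (W t v).2.2 + q.2.2 * (W t v).2.1) / 2) • R (Θ t q).1,
        (0:ℝ), (0:ℝ)) : V3 × ℝ × ℝ) (Icc 0 1) t := by
    intro t ht
    have := (hW t ht).clm_apply (hasDerivWithinAt_const t (Icc (0:ℝ) 1) v)
    simp only [ContinuousLinearMap.comp_apply, map_zero, add_zero, hDX, hfib] at this
    exact this
  have hw1 := fun t ht => (ContinuousLinearMap.fst ℝ V3 (ℝ × ℝ)).hasFDerivAt.comp_hasDerivWithinAt
    t (hw t ht)
  have hw2 := fun t ht => (ContinuousLinearMap.snd ℝ V3 (ℝ × ℝ)).hasFDerivAt.comp_hasDerivWithinAt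
    t (hw t ht)
  have hΘ1 := fun t ht => (ContinuousLinearMap.fst ℝ V3 (ℝ × ℝ)).hasFDerivAt.comp_hasDerivWithinAt
    t (hΘ.2 q t ht)
  have hw2c : ∀ t ∈ Icc (0:ℝ) 1, (W t v).2 = v.2 := by
    intro t ht
    have := constant_of_has_deriv_right_zero (f := fun t => (W t v).2) (a := 0) (b := 1)
      (fun t ht => (hw2 t ht).continuousWithinAt)
      (fun t ht => aux_icc_ici ht (hw2 t (Ico_subset_Icc_self ht))) t ht
    rw [this, hW0]; rfl
  set k : ℝ := (q.2.1 * v.2.2 + q.2.2 * v.2.1) / 2 with hk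
  have hg : ∀ t ∈ Icc (0:ℝ) 1, HasDerivWithinAt (fun t => α (Θ t q).1 (W t v).1 - t * k) 0
      (Icc 0 1) t := by
    intro t ht
    have h1 : HasDerivWithinAt (fun t => α (Θ t q).1) _ (Icc 0 1) t :=
      (hα.differentiable one_ne_zero (Θ t q).1).hasFDerivAt.comp_hasDerivWithinAt t (hΘ1 t ht)
    have h2 := (h1.clm_apply (hw1 t ht)).sub (((hasDerivAt_id t).mul_const k).hasDerivWithinAt)
    refine h2.congr_deriv ?_
    have h3 : fderiv ℝ α (Θ t q).1 (W t v).1 (R (Θ t q).1)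
        + α (Θ t q).1 (fderiv ℝ R (Θ t q).1 (W t v).1) = 0 := by
      have a1 := (hα.differentiable one_ne_zero (Θ t q).1).hasFDerivAt.clm_apply
        (hR.differentiable one_ne_zero (Θ t q).1).hasFDerivAt
      have a2 : (fun y => (α y) (R y)) = fun _ => (1:ℝ) := funext hR1
      rw [a2] at a1
      have a3 := a1.unique (hasFDerivAt_const (1:ℝ) (Θ t q).1)
      have a4 := DFunLike.congr_fun a3 (W t v).1
      simp at a4
      linarith
    have h4 := hR2 (Θ t q).1 (W t v).1
    simp only [d2] at h4
    have h5 := hw2c t ht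
    have h6 := hR1 (Θ t q).1
    simp [hfib, h5, h6]
    rw [hk]
    linear_combination (q.2.1 * q.2.2 / 2) * (h3 + h4)
  have hconst := constant_of_has_deriv_right_zero
    (fun t ht => (hg t ht).continuousWithinAt)
    (fun t ht => aux_icc_ici ht (hg t (Ico_subset_Icc_self ht))) 1 (by simp)
  simp only [hW0, hΘ.1, ContinuousLinearMap.id_apply] at hconst
  have h5 := hw2c 1 (by simp)
  rw [h5, hfib]
  rw [hk] at hconst
  linarith

end Helpers

theorem flow_strict_contactomorphism
    (α : V3 → V3 →L[ℝ] ℝ) (hα : IsContactForm3 α)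
    (R : V3 → V3)
    -- R is the Reeb vector field of α
    (hR1 : ∀ p, α p (R p) = 1) (hR2 : ∀ p v, d2 α p (R p) v = 0)
    -- R is complete: it has a globally defined flow
    (hRcomplete : ∃ Φ : ℝ → V3 → V3, (∀ p, Φ 0 p = p) ∧
      ∀ p t, HasDerivAt (fun u => Φ u p) (R (Φ t p)) t) :
    -- X(p,x,y) = (xy/2)·R(p) is complete: there is a globally defined flow Θ
    ∃ Θ : ℝ → V3 × ℝ × ℝ → V3 × ℝ × ℝ,
      (∀ q, Θ 0 q = q) ∧
      (∀ q t, HasDerivAt (fun u => Θ u q)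
        ((((Θ t q).2.1 * (Θ t q).2.2 / 2) • R (Θ t q).1, (0 : ℝ), (0 : ℝ)) : V3 × ℝ × ℝ) t) ∧
      -- the time-1 flow Ψ = Θ 1 is a diffeomorphism (inverse: the time-(-1) flow)
      (ContDiff ℝ (⊤ : ℕ∞) (Θ 1) ∧ Function.Bijective (Θ 1) ∧
        ContDiff ℝ (⊤ : ℕ∞) (Θ (-1)) ∧ Function.LeftInverse (Θ (-1)) (Θ 1)) ∧
      -- Ψ preserves the fibres of the projection onto ℝ²(x,y)
      (∀ q : V3 × ℝ × ℝ, ((Θ 1) q).2 = q.2) ∧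
      -- Ψ*(α - y dx) = α + ½(x dy - y dx): a strict contactomorphism
      (∀ q v : V3 × ℝ × ℝ,
        α ((Θ 1) q).1 (fderiv ℝ (Θ 1) q v).1 - ((Θ 1) q).2.2 * (fderiv ℝ (Θ 1) q v).2.1
          = α q.1 v.1 + (q.2.1 * v.2.2 - q.2.2 * v.2.1) / 2) := by
  obtain ⟨Φ, h0, hd⟩ := hRcomplete
  have hR : ContDiff ℝ (⊤ : ℕ∞) R := reeb_smooth α hα R hR1 hR2
  have hle : (1 : WithTop ℕ∞) ≤ ((⊤ : ℕ∞) : WithTop ℕ∞) := by exact_mod_cast le_top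
  have hadd := complete_flow_add R (hR.of_le hle) Φ h0 hd
  have hX : ContDiff ℝ (⊤ : ℕ∞) (fun q : V3 × ℝ × ℝ =>
      (((q.2.1 * q.2.2 / 2) • R q.1, (0:ℝ), (0:ℝ)) : V3 × ℝ × ℝ)) := by
    have : ContDiff ℝ (⊤ : ℕ∞) (fun q : V3 × ℝ × ℝ => R q.1) := hR.comp contDiff_fst
    fun_prop
  let Θ : ℝ → V3 × ℝ × ℝ → V3 × ℝ × ℝ := fun t q => (Φ (t * (q.2.1 * q.2.2 / 2)) q.1, q.2)
  have hΘ0 : ∀ q, Θ 0 q = q := fun q => by simp [Θ, h0]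
  have hΘd : ∀ q t, HasDerivAt (fun u => Θ u q)
        ((((Θ t q).2.1 * (Θ t q).2.2 / 2) • R (Θ t q).1, (0 : ℝ), (0 : ℝ)) : V3 × ℝ × ℝ) t := by
    intro q t
    have h1 : HasDerivAt (fun u : ℝ => u * (q.2.1 * q.2.2 / 2)) (1 * (q.2.1 * q.2.2 / 2)) t :=
      (hasDerivAt_id t).mul_const _
    have h2 := HasDerivAt.scomp t (hd q.1 (t * (q.2.1 * q.2.2 / 2))) h1
    rw [one_mul] at h2
    exact h2.prodMk (hasDerivAt_const t q.2)
  have hfl : IsFlow01 (fun q : V3 × ℝ × ℝ =>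
      (((q.2.1 * q.2.2 / 2) • R q.1, (0:ℝ), (0:ℝ)) : V3 × ℝ × ℝ)) Θ :=
    ⟨hΘ0, fun q t _ => (hΘd q t).hasDerivWithinAt⟩
  have hfl2 : IsFlow01 (fun q : V3 × ℝ × ℝ =>
      -(((q.2.1 * q.2.2 / 2) • R q.1, (0:ℝ), (0:ℝ)) : V3 × ℝ × ℝ)) (fun t => Θ (-t)) := by
    refine ⟨fun q => by simp [hΘ0], fun q t _ => ?_⟩
    have := HasDerivAt.scomp t (hΘd q (-t)) (hasDerivAt_neg t)
    rw [neg_one_smul] at this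
    exact this.hasDerivWithinAt
  have hl : Function.LeftInverse (Θ (-1)) (Θ 1) := fun q => by simp [Θ, hadd, h0]
  have hr : Function.RightInverse (Θ (-1)) (Θ 1) := fun q => by simp [Θ, hadd, h0]
  refine ⟨Θ, hΘ0, hΘd, ⟨flow_contDiff _ hX Θ hfl, ⟨hl.injective, hr.surjective⟩, ?_, hl⟩,
    fun q => rfl, ?_⟩
  · exact flow_contDiff _ hX.neg (fun t => Θ (-t)) hfl2
  · exact pullback_aux α (hα.1.of_le hle) R (hR.of_le hle) hR1 hR2 Θ (hX.of_le hle) hfl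
      (fun t q => rfl)
end
end

section
/- Let α₀ = dz + ρ² dφ be the standard contact form on ℝ³ and let α₀⁵ = dz + ρ₁² dφ₁ + ρ₂² dφ₂ be the standard contact form on ℝ⁵ (in cylindrical/polar coordinates). Then the contactization of the symplectization CS(ℝ³, α₀) = (ℝ³ × ℝ⁺(t) × ℝ(s), ker(tα₀ − ds)) is contactomorphic to (ℝ⁵, ker α₀⁵). -/
/-!
STATEMENT 10: The contactization of the symplectization of the standard contact
ℝ³, CS(ℝ³, α₀) = (ℝ³ × ℝ⁺(t) × ℝ(s), ker(t α₀ - ds)), is contactomorphic to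
standard contact ℝ⁵, (ℝ⁵, ker(dz + ρ₁²dφ₁ + ρ₂²dφ₂)).
In Cartesian coordinates (x₁,y₁,x₂,y₂,z) on ℝ⁵ the standard contact form reads
dz + x₁ dy₁ - y₁ dx₁ + x₂ dy₂ - y₂ dx₂, and on ℝ³, α₀ = dz + x dy - y dx.
-/

noncomputable section

abbrev V5 : Type := Fin 5 → ℝ

/-- the standard contact form α₀ = dz + ρ²dφ on ℝ³ -/
def alpha0 : V3 → V3 →L[ℝ] ℝ := fun p =>
  (ContinuousLinearMap.proj 2 : V3 →L[ℝ] ℝ)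
    + p 0 • (ContinuousLinearMap.proj 1 : V3 →L[ℝ] ℝ)
    - p 1 • (ContinuousLinearMap.proj 0 : V3 →L[ℝ] ℝ)

/-- the standard contact form dz + ρ₁²dφ₁ + ρ₂²dφ₂ on ℝ⁵ -/
def alpha0five : V5 → V5 →L[ℝ] ℝ := fun p =>
  (ContinuousLinearMap.proj 4 : V5 →L[ℝ] ℝ)
    + p 0 • (ContinuousLinearMap.proj 1 : V5 →L[ℝ] ℝ)
    - p 1 • (ContinuousLinearMap.proj 0 : V5 →L[ℝ] ℝ)
    + p 2 • (ContinuousLinearMap.proj 3 : V5 →L[ℝ] ℝ)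
    - p 3 • (ContinuousLinearMap.proj 2 : V5 →L[ℝ] ℝ)

/-- ℝ³ × ℝ⁺(t) × ℝ(s) -/
def posT : Set (V3 × ℝ × ℝ) := {q | 0 < q.2.1}

/-- the contactomorphism -/
def csPhi (q : V3 × ℝ × ℝ) : V5 :=
  ![Real.exp (Real.log q.2.1 / 2) * q.1 1, Real.exp (Real.log q.2.1 / 2) * q.1 0,
    q.2.1 * q.1 2, Real.log q.2.1 / 2,
    q.2.2 - q.2.1 * q.1 2 + q.2.1 * q.1 2 * (Real.log q.2.1 / 2)]

/-- its inverse -/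
def csPsi (p : V5) : V3 × ℝ × ℝ :=
  (![Real.exp (-p 3) * p 1, Real.exp (-p 3) * p 0, Real.exp (-(2 * p 3)) * p 2],
    Real.exp (2 * p 3), p 4 + p 2 - p 2 * p 3)

lemma csPsi_csPhi (q : V3 × ℝ × ℝ) (hq : q ∈ posT) : csPsi (csPhi q) = q := by
  obtain ⟨p, t, s⟩ := q
  have ht : 0 < t := hq
  have e1 : Real.exp (2 * (Real.log t / 2)) = t := by
    rw [mul_div_cancel₀ _ (two_ne_zero)]; exact Real.exp_log ht
  refine Prod.ext ?_ (Prod.ext ?_ ?_)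
  · funext i
    fin_cases i
    · simp [csPsi, csPhi, ← mul_assoc, ← Real.exp_add]
    · simp [csPsi, csPhi, ← mul_assoc, ← Real.exp_add]
    · simp only [csPsi, csPhi, Real.exp_neg]
      simp [Real.exp_log ht, mul_div_cancel₀, ht.ne']
  · simpa [csPsi, csPhi] using e1
  · simp [csPsi, csPhi]; ring

lemma csPhi_csPsi (p : V5) : csPhi (csPsi p) = p := by
  funext i
  fin_cases i
  · simp [csPsi, csPhi, ← mul_assoc, ← Real.exp_add]
  · simp [csPsi, csPhi, ← mul_assoc, ← Real.exp_add]
  · simp [csPsi, csPhi, ← mul_assoc, ← Real.exp_add]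
  · simp [csPsi, csPhi]
  · simp [csPsi, csPhi, ← mul_assoc, ← Real.exp_add]; ring

lemma csPhi_contDiffAt (q : V3 × ℝ × ℝ) (hq : q ∈ posT) :
    ContDiffAt ℝ (⊤ : ℕ∞) csPhi q := by
  have ht : q.2.1 ≠ 0 := ne_of_gt hq
  have hl : ContDiffAt ℝ (⊤ : ℕ∞) (fun q : V3 × ℝ × ℝ => Real.log q.2.1 / 2) q :=
    ((contDiffAt_fst.comp q contDiffAt_snd).log ht).div_const 2
  have hx (i : Fin 3) : ContDiffAt ℝ (⊤ : ℕ∞) (fun q : V3 × ℝ × ℝ => q.1 i) q := by fun_prop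
  have h1 : ContDiffAt ℝ (⊤ : ℕ∞) (fun q : V3 × ℝ × ℝ => q.2.1) q := by fun_prop
  have h2 : ContDiffAt ℝ (⊤ : ℕ∞) (fun q : V3 × ℝ × ℝ => q.2.2) q := by fun_prop
  rw [contDiffAt_pi]
  intro i
  fin_cases i
  · exact hl.exp.mul (hx 1)
  · exact hl.exp.mul (hx 0)
  · exact h1.mul (hx 2)
  · exact hl
  · exact (h2.sub (h1.mul (hx 2))).add ((h1.mul (hx 2)).mul hl)

lemma csPsi_differentiable : Differentiable ℝ csPsi := by
  refine Differentiable.prodMk ?_ (by fun_prop)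
  rw [differentiable_pi]
  intro i
  fin_cases i <;> simp <;> fun_prop

lemma posT_open : IsOpen posT :=
  isOpen_lt continuous_const (continuous_fst.comp continuous_snd)

lemma csPhi_fderiv (q : V3 × ℝ × ℝ) (hq : q ∈ posT) (v : V3 × ℝ × ℝ) :
    fderiv ℝ csPhi q v =
      ![Real.exp (Real.log q.2.1 / 2) * (v.2.1 / q.2.1 / 2) * q.1 1
          + Real.exp (Real.log q.2.1 / 2) * v.1 1,
        Real.exp (Real.log q.2.1 / 2) * (v.2.1 / q.2.1 / 2) * q.1 0
          + Real.exp (Real.log q.2.1 / 2) * v.1 0,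
        v.2.1 * q.1 2 + q.2.1 * v.1 2,
        v.2.1 / q.2.1 / 2,
        v.2.2 - (v.2.1 * q.1 2 + q.2.1 * v.1 2)
          + ((v.2.1 * q.1 2 + q.2.1 * v.1 2) * (Real.log q.2.1 / 2)
            + q.2.1 * q.1 2 * (v.2.1 / q.2.1 / 2))] := by
  have ht : q.2.1 ≠ 0 := ne_of_gt hq
  have hd := ((csPhi_contDiffAt q hq).differentiableAt (by simp)).hasFDerivAt
  have h1 : HasFDerivAt (fun q : V3 × ℝ × ℝ => q.2.1)
      ((ContinuousLinearMap.fst ℝ ℝ ℝ).comp (ContinuousLinearMap.snd ℝ V3 (ℝ × ℝ))) q :=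
    ((ContinuousLinearMap.fst ℝ ℝ ℝ).comp
      (ContinuousLinearMap.snd ℝ V3 (ℝ × ℝ))).hasFDerivAt
  have h2 : HasFDerivAt (fun q : V3 × ℝ × ℝ => q.2.2)
      ((ContinuousLinearMap.snd ℝ ℝ ℝ).comp (ContinuousLinearMap.snd ℝ V3 (ℝ × ℝ))) q :=
    ((ContinuousLinearMap.snd ℝ ℝ ℝ).comp
      (ContinuousLinearMap.snd ℝ V3 (ℝ × ℝ))).hasFDerivAt
  have hx (i : Fin 3) : HasFDerivAt (fun q : V3 × ℝ × ℝ => q.1 i)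
      ((ContinuousLinearMap.proj i : V3 →L[ℝ] ℝ).comp
        (ContinuousLinearMap.fst ℝ V3 (ℝ × ℝ))) q :=
    ((ContinuousLinearMap.proj i : V3 →L[ℝ] ℝ).comp
      (ContinuousLinearMap.fst ℝ V3 (ℝ × ℝ))).hasFDerivAt
  have hl := (h1.log ht).mul_const (2⁻¹ : ℝ)
  simp only [← div_eq_mul_inv] at hl
  have key (i : Fin 5) := hasFDerivAt_pi'.1 hd i
  funext i
  fin_cases i
  · have := congrArg (fun L => L v) ((key 0).unique (hl.exp.mul (hx 1)))
    simp at this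
    simp [this]; ring
  · have := congrArg (fun L => L v) ((key 1).unique (hl.exp.mul (hx 0)))
    simp at this
    simp [this]; ring
  · have := congrArg (fun L => L v) ((key 2).unique (h1.mul (hx 2)))
    simp at this
    simp [this]; ring
  · have := congrArg (fun L => L v) ((key 3).unique hl)
    simp at this
    simp [this]; ring
  · have := congrArg (fun L => L v) ((key 4).unique
      ((h2.sub (h1.mul (hx 2))).add ((h1.mul (hx 2)).mul hl)))
    simp at this
    simp [this]; ring

theorem CS_standard_R3_contactomorphic_standard_R5 :
    ∃ φ : V3 × ℝ × ℝ → V5,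
      ContDiffOn ℝ (⊤ : ℕ∞) φ posT ∧ Set.InjOn φ posT ∧ φ '' posT = Set.univ ∧
      (∀ q ∈ posT, Function.Injective (fderiv ℝ φ q)) ∧
      ∃ h : V3 × ℝ × ℝ → ℝ, (∀ q ∈ posT, h q ≠ 0) ∧
        -- φ*(standard contact form on ℝ⁵) = h · (t α₀ - ds)
        ∀ q ∈ posT, ∀ v : V3 × ℝ × ℝ,
          alpha0five (φ q) (fderiv ℝ φ q v)
            = h q * (q.2.1 * alpha0 q.1 v.1 - v.2.2) := by
  refine ⟨csPhi, fun q hq => (csPhi_contDiffAt q hq).contDiffWithinAt, ?_, ?_, ?_,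
    fun _ => -1, by simp, ?_⟩
  · intro a ha b hb hab
    rw [← csPsi_csPhi a ha, hab, csPsi_csPhi b hb]
  · refine Set.eq_univ_of_forall fun p => ⟨csPsi p, ?_, csPhi_csPsi p⟩
    exact Real.exp_pos _
  · intro q hq
    have hd := ((csPhi_contDiffAt q hq).differentiableAt (by simp)).hasFDerivAt
    have hc := (csPsi_differentiable (csPhi q)).hasFDerivAt.comp q hd
    have hid : HasFDerivAt (csPsi ∘ csPhi) (ContinuousLinearMap.id ℝ (V3 × ℝ × ℝ)) q := by
      refine (hasFDerivAt_id q).congr_of_eventuallyEq ?_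
      filter_upwards [posT_open.mem_nhds hq] with x hx
      exact csPsi_csPhi x hx
    have he := hc.unique hid
    intro a b hab
    have ha := congrArg (fun L => L a) he
    have hb := congrArg (fun L => L b) he
    simp only [ContinuousLinearMap.comp_apply, ContinuousLinearMap.id_apply] at ha hb
    rw [← ha, ← hb, hab]
  · intro q hq v
    rw [csPhi_fderiv q hq v]
    have ht : 0 < q.2.1 := hq
    have e1 : Real.exp (Real.log q.2.1 / 2) ^ 2 = q.2.1 := by
      rw [← Real.exp_nat_mul]; push_cast
      rw [mul_div_cancel₀ _ (two_ne_zero)]; exact Real.exp_log ht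
    have e2 : q.2.1 * q.2.1⁻¹ = 1 := mul_inv_cancel₀ ht.ne'
    simp [alpha0five, alpha0, csPhi]
    generalize Real.exp (Real.log q.2.1 / 2) = E at *
    generalize Real.log q.2.1 = l at *
    linear_combination (q.1 1 * v.1 0 - q.1 0 * v.1 1) * e1 + v.2.1 * q.1 2 * e2
end
end
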